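/- Let K be a field of characteristic zero containing a primitive 5th root of unity zeta; set phi = 1 + zeta + zeta^4 and kappa = zeta^4 - zeta. Let M_T be the 2x2 matrix [[zeta^2, 0],[0, zeta^3]] and M_S = kappa^{-1} * [[phi, 1],[1, -phi]], both in GL_2(K). Then det(M_S) = det(M_T) = 1, and the subgroup of GL_2(K) generated by M_S and M_T has exactly 120 elements and is isomorphic as a group to SL_2(Z/5Z). -/

import Mathlib

open Matrix

/-- Normal forms in a group with elements `S`, `T`, `D`. -/
def InNF {P : Type*} [Group P] (S T D x : P) : Prop :=
  (∃ i b : ℕ, x = D ^ i * T ^ b) ∨ (∃ i a b : ℕ, x = D ^ i * T ^ a * S * T ^ b)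

/-- The relations used for the Bruhat-type normal form. -/
structure NFRel {P : Type*} [Group P] (S T D : P) : Prop where
  hT : T ^ 5 = 1
  hD : D ^ 4 = 1
  hTD : T * D = D * T ^ 4
  hSD : S * D = D ^ 3 * S
  h0 : S * S = D ^ 2
  h1 : S * T * S = D ^ 2 * T ^ 4 * S * T ^ 4
  h2 : S * T ^ 2 * S = D * T ^ 3 * S * T ^ 2
  h3 : S * T ^ 3 * S = D ^ 3 * T ^ 2 * S * T ^ 3
  h4 : S * T ^ 4 * S = T * S * T

namespace NFRel
variable {P : Type*} [Group P] {S T D : P}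

lemma T_pow_D (h : NFRel S T D) (n : ℕ) : T ^ n * D = D * T ^ (4 * n) := by
  induction n with
  | zero => simp
  | succ n ih =>
    rw [pow_succ, mul_assoc, h.hTD, ← mul_assoc, ih, mul_assoc, ← pow_add]; rfl

lemma T_D_pow (h : NFRel S T D) (i : ℕ) : ∃ k : ℕ, T * D ^ i = D ^ i * T ^ k := by
  induction i with
  | zero => exact ⟨1, by simp⟩
  | succ n ih =>
    obtain ⟨k, hk⟩ := ih
    exact ⟨4 * k, by rw [pow_succ, ← mul_assoc, hk, mul_assoc, h.T_pow_D, mul_assoc]⟩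

lemma S_D_pow (h : NFRel S T D) (i : ℕ) : S * D ^ i = D ^ (3 * i) * S := by
  induction i with
  | zero => simp
  | succ n ih =>
    rw [pow_succ, ← mul_assoc, ih, mul_assoc, h.hSD, ← mul_assoc, ← pow_add]; rfl

lemma mulT (h : NFRel S T D) {x : P} (hx : InNF S T D x) : InNF S T D (T * x) := by
  rcases hx with ⟨i, b, rfl⟩ | ⟨i, a, b, rfl⟩
  · obtain ⟨k, hk⟩ := h.T_D_pow i
    exact Or.inl ⟨i, k + b, by rw [← mul_assoc, hk, mul_assoc, ← pow_add]⟩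
  · obtain ⟨k, hk⟩ := h.T_D_pow i
    refine Or.inr ⟨i, k + a, b, ?_⟩
    simp only [← mul_assoc]
    rw [hk, pow_add]
    simp only [mul_assoc]

lemma STS (h : NFRel S T D) (a : ℕ) :
    (∃ i, S * T ^ a * S = D ^ i) ∨
      ∃ i c d : ℕ, S * T ^ a * S = D ^ i * T ^ c * S * T ^ d := by
  have e : T ^ a = T ^ (a % 5) := pow_eq_pow_mod a h.hT
  rw [e]
  have : a % 5 < 5 := Nat.mod_lt _ (by norm_num)
  interval_cases a % 5
  · exact Or.inl ⟨2, by simpa using h.h0⟩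
  · exact Or.inr ⟨2, 4, 4, by simpa using h.h1⟩
  · exact Or.inr ⟨1, 3, 2, by simpa using h.h2⟩
  · exact Or.inr ⟨3, 2, 3, by simpa using h.h3⟩
  · exact Or.inr ⟨0, 1, 1, by simpa using h.h4⟩

lemma mulS (h : NFRel S T D) {x : P} (hx : InNF S T D x) : InNF S T D (S * x) := by
  rcases hx with ⟨i, b, rfl⟩ | ⟨i, a, b, rfl⟩
  · exact Or.inr ⟨3 * i, 0, b, by rw [← mul_assoc, h.S_D_pow]; simp⟩
  · have e : S * (D ^ i * T ^ a * S * T ^ b) = D ^ (3 * i) * (S * T ^ a * S) * T ^ b := by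
      simp only [← mul_assoc]
      rw [h.S_D_pow]
    rw [e]
    rcases h.STS a with ⟨j, hj⟩ | ⟨j, c, d, hj⟩
    · exact Or.inl ⟨3 * i + j, b, by rw [hj, pow_add]⟩
    · exact Or.inr ⟨3 * i + j, c, d + b, by rw [hj]; simp only [pow_add, mul_assoc]⟩

lemma mem (h : NFRel S T D) {x : P} (hx : x ∈ Subgroup.closure ({S, T} : Set P)) :
    InNF S T D x := by
  have hS4 : S⁻¹ = S * (S * S) := by
    rw [inv_eq_iff_mul_eq_one]
    have : S * (S * (S * S)) = D ^ 2 * D ^ 2 := by rw [h.h0, ← mul_assoc, h.h0]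
    rw [this, ← pow_add, h.hD]
  have hT5 : T⁻¹ = T * (T * (T * T)) := by
    rw [inv_eq_iff_mul_eq_one, ← h.hT]
    simp only [pow_succ, pow_zero, one_mul, mul_assoc]
  induction hx using Subgroup.closure_induction_left with
  | one => exact Or.inl ⟨0, 0, by simp⟩
  | mul_left y hy z hz ih =>
    rcases hy with rfl | rfl
    · exact h.mulS ih
    · exact h.mulT ih
  | inv_mul_cancel y hy z hz ih =>
    rcases hy with rfl | rfl
    · rw [hS4]; simp only [mul_assoc]; exact h.mulS (h.mulS (h.mulS ih))
    · rw [hT5]; simp only [mul_assoc]; exact h.mulT (h.mulT (h.mulT (h.mulT ih)))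

lemma prod {Q : Type*} [Group Q] {S' T' D' : Q} (h : NFRel S T D) (h' : NFRel S' T' D') :
    NFRel (S, S') (T, T') (D, D') := by
  constructor <;> ext <;> simp [h.hT, h.hD, h.hTD, h.hSD, h.h0, h.h1, h.h2, h.h3, h.h4,
    h'.hT, h'.hD, h'.hTD, h'.hSD, h'.h0, h'.h1, h'.h2, h'.h3, h'.h4]

/-- Normal form with reduced exponents. -/
lemma reduced (h : NFRel S T D) {x : P} (hx : InNF S T D x) :
    (∃ i b : ℕ, i < 4 ∧ b < 5 ∧ x = D ^ i * T ^ b) ∨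
    (∃ i a b : ℕ, i < 4 ∧ a < 5 ∧ b < 5 ∧ x = D ^ i * T ^ a * S * T ^ b) := by
  rcases hx with ⟨i, b, rfl⟩ | ⟨i, a, b, rfl⟩
  · refine Or.inl ⟨i % 4, b % 5, Nat.mod_lt _ (by norm_num), Nat.mod_lt _ (by norm_num), ?_⟩
    rw [← pow_eq_pow_mod i h.hD, ← pow_eq_pow_mod b h.hT]
  · refine Or.inr ⟨i % 4, a % 5, b % 5, Nat.mod_lt _ (by norm_num), Nat.mod_lt _ (by norm_num),
      Nat.mod_lt _ (by norm_num), ?_⟩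
    rw [← pow_eq_pow_mod i h.hD, ← pow_eq_pow_mod b h.hT, ← pow_eq_pow_mod a h.hT]

/-- Faithfulness: the only trivial reduced normal form is the empty one. -/
structure Faithful (S T D : P) : Prop where
  f0 : ∀ i < 4, ∀ b < 5, D ^ i * T ^ b = 1 → i = 0 ∧ b = 0
  f1 : ∀ i < 4, ∀ a < 5, ∀ b < 5, D ^ i * T ^ a * S * T ^ b ≠ 1

/-- Two groups generated by faithful pairs satisfying the relations are isomorphic. -/
lemma iso {Q : Type*} [Group Q] {S' T' D' : Q} (h : NFRel S T D) (h' : NFRel S' T' D')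
    (f : Faithful S T D) (f' : Faithful S' T' D') :
    Nonempty (Subgroup.closure ({S, T} : Set P) ≃* Subgroup.closure ({S', T'} : Set Q)) := by
  let Γ : Subgroup (P × Q) := Subgroup.closure {(S, S'), (T, T')}
  have key : ∀ x ∈ Γ, (x.1 = 1 → x = 1) ∧ (x.2 = 1 → x = 1) := by
    intro x hx
    rcases (h.prod h').reduced ((h.prod h').mem hx) with
      ⟨i, b, hi, hb, rfl⟩ | ⟨i, a, b, hi, ha, hb, rfl⟩
    · constructor
      · intro e
        obtain ⟨rfl, rfl⟩ := f.f0 i hi b hb (by simpa using e)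
        simp
      · intro e
        obtain ⟨rfl, rfl⟩ := f'.f0 i hi b hb (by simpa using e)
        simp
    · exact ⟨fun e => absurd (by simpa using e) (f.f1 i hi a ha b hb),
        fun e => absurd (by simpa using e) (f'.f1 i hi a ha b hb)⟩
  have e1 : Γ.map (MonoidHom.fst P Q) = Subgroup.closure {S, T} := by
    simp only [Γ, MonoidHom.map_closure, Set.image_pair, MonoidHom.coe_fst]
  have e2 : Γ.map (MonoidHom.snd P Q) = Subgroup.closure {S', T'} := by
    simp only [Γ, MonoidHom.map_closure, Set.image_pair, MonoidHom.coe_snd]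
  let g1 : Γ →* P := (MonoidHom.fst P Q).comp Γ.subtype
  let g2 : Γ →* Q := (MonoidHom.snd P Q).comp Γ.subtype
  have i1 : Function.Injective g1 := by
    rw [injective_iff_map_eq_one]
    rintro ⟨x, hx⟩ e
    exact Subtype.ext ((key x hx).1 e)
  have i2 : Function.Injective g2 := by
    rw [injective_iff_map_eq_one]
    rintro ⟨x, hx⟩ e
    exact Subtype.ext ((key x hx).2 e)
  have r1 : g1.range = Subgroup.closure {S, T} := by
    rw [← e1, MonoidHom.range_comp, Subgroup.range_subtype]
  have r2 : g2.range = Subgroup.closure {S', T'} := by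
    rw [← e2, MonoidHom.range_comp, Subgroup.range_subtype]
  rw [← r1, ← r2]
  exact ⟨(MonoidHom.ofInjective i1).symm.trans (MonoidHom.ofInjective i2)⟩

end NFRel

/-- The group `SL₂(𝔽₅)`. -/
abbrev SLF := Matrix.SpecialLinearGroup (Fin 2) (ZMod 5)

def sF : SLF := ⟨!![0, 1; -1, 0], by decide⟩
def tF : SLF := ⟨!![1, 1; 0, 1], by decide⟩
def dF : SLF := ⟨!![2, 0; 0, 3], by decide⟩

lemma relF : NFRel sF tF dF := by
  constructor <;> decide

lemma tF_pow (n : ℕ) : ((tF ^ n : SLF) : Matrix (Fin 2) (Fin 2) (ZMod 5)) = !![1, (n : ZMod 5); 0, 1] := by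
  induction n with
  | zero => ext i j; fin_cases i <;> fin_cases j <;> simp
  | succ n ih =>
    rw [pow_succ, Matrix.SpecialLinearGroup.coe_mul, ih]
    ext i j; fin_cases i <;> fin_cases j <;> simp [tF, add_comm]

lemma faithF : NFRel.Faithful sF tF dF := by
  constructor
  · decide
  · decide

lemma card_SLF : Nat.card SLF = 120 := by
  rw [Nat.card_eq_fintype_card]
  decide +kernel

instance : Fact (Nat.Prime 5) := ⟨by norm_num⟩

/-- Upper unipotent matrices. -/
def nF (x : ZMod 5) : SLF := ⟨!![1, x; 0, 1], by simp⟩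
/-- Lower unipotent matrices. -/
def lF (x : ZMod 5) : SLF := ⟨!![1, 0; x, 1], by simp⟩

lemma nF_eq : ∀ x : ZMod 5, nF x = tF ^ x.val := by decide
lemma lF_eq : ∀ x : ZMod 5, lF x = sF * tF ^ (-x).val * sF⁻¹ := by decide

lemma decomp {F : Type*} [Field F] (A : Matrix (Fin 2) (Fin 2) F) (hA : A 1 0 ≠ 0)
    (hd : A 0 0 * A 1 1 - A 0 1 * A 1 0 = 1) :
    A = !![1, (A 0 0 - 1) / A 1 0; 0, 1] * !![1, 0; A 1 0, 1] *
      !![1, (A 1 1 - 1) / A 1 0; 0, 1] := by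
  ext i j
  fin_cases i <;> fin_cases j <;> simp [Matrix.mul_apply, Fin.sum_univ_two] <;> grind

lemma closF : Subgroup.closure ({sF, tF} : Set SLF) = ⊤ := by
  have hs : sF ∈ Subgroup.closure ({sF, tF} : Set SLF) := Subgroup.subset_closure (by simp)
  have ht : tF ∈ Subgroup.closure ({sF, tF} : Set SLF) := Subgroup.subset_closure (by simp)
  have hn (x) : nF x ∈ Subgroup.closure ({sF, tF} : Set SLF) := by
    rw [nF_eq]; exact pow_mem ht _
  have hl (x) : lF x ∈ Subgroup.closure ({sF, tF} : Set SLF) := by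
    rw [lF_eq]; exact mul_mem (mul_mem hs (pow_mem ht _)) (inv_mem hs)
  have main (A : SLF) (hA : A.1 1 0 ≠ 0) : A ∈ Subgroup.closure ({sF, tF} : Set SLF) := by
    have hd : A.1 0 0 * A.1 1 1 - A.1 0 1 * A.1 1 0 = 1 := by
      rw [← Matrix.det_fin_two]; exact A.2
    have : A = nF ((A.1 0 0 - 1) / A.1 1 0) * lF (A.1 1 0) * nF ((A.1 1 1 - 1) / A.1 1 0) := by
      apply Subtype.ext
      rw [Matrix.SpecialLinearGroup.coe_mul, Matrix.SpecialLinearGroup.coe_mul]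
      exact decomp A.1 hA hd
    rw [this]
    exact mul_mem (mul_mem (hn _) (hl _)) (hn _)
  rw [eq_top_iff]
  rintro A -
  by_cases hA : A.1 1 0 = 0
  · have hd : A.1 0 0 * A.1 1 1 - A.1 0 1 * A.1 1 0 = 1 := by
      rw [← Matrix.det_fin_two]; exact A.2
    have h2 : sF * A ∈ Subgroup.closure ({sF, tF} : Set SLF) := by
      apply main
      have : (sF * A).1 1 0 = - A.1 0 0 := by
        change (sF.1 * A.1) 1 0 = _
        simp [sF, Matrix.mul_apply, Fin.sum_univ_two]
      rw [this]
      intro h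
      rw [neg_eq_zero] at h
      rw [h, hA] at hd
      simp at hd
    exact (Subgroup.mul_mem_cancel_left _ hs).1 h2
  · exact main A hA

section K
set_option linter.unusedSectionVars false
variable {K : Type*} [Field K] [CharZero K] {ζ : K}

lemma phi5 (hζ : IsPrimitiveRoot ζ 5) : 1 + ζ + ζ ^ 2 + ζ ^ 3 + ζ ^ 4 = 0 := by
  have := hζ.geom_sum_eq_zero (by norm_num)
  simpa [Finset.sum_range_succ] using this

lemma kappa_inv (h : 1 + ζ + ζ ^ 2 + ζ ^ 3 + ζ ^ 4 = 0) :
    (ζ ^ 4 - ζ)⁻¹ = (2 * ζ - ζ ^ 2 + ζ ^ 3 - 2 * ζ ^ 4) / 5 := by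
  apply inv_eq_of_mul_eq_one_right
  grind

lemma diag_pow (a b : K) (n : ℕ) : !![a, 0; 0, b] ^ n = !![a ^ n, 0; 0, b ^ n] := by
  induction n with
  | zero => ext i j; fin_cases i <;> fin_cases j <;> simp
  | succ n ih =>
    rw [pow_succ, ih]
    ext i j; fin_cases i <;> fin_cases j <;> simp [pow_succ]

/-- The matrix `D` over `K`. -/
def dK (K : Type*) [Field K] : GL (Fin 2) K :=
  Matrix.GeneralLinearGroup.mkOfDetNeZero !![0, -1; 1, 0] (by simp)

lemma dK_coe : (dK K : Matrix (Fin 2) (Fin 2) K) = !![0, -1; 1, 0] := rfl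

lemma relK (h : 1 + ζ + ζ ^ 2 + ζ ^ 3 + ζ ^ 4 = 0) (h5 : ζ ^ 5 = 1) (MS MT : GL (Fin 2) K)
    (c φ : K) (hc : c = (2 * ζ - ζ ^ 2 + ζ ^ 3 - 2 * ζ ^ 4) / 5) (hφ : φ = 1 + ζ + ζ ^ 4)
    (hMS : (MS : Matrix (Fin 2) (Fin 2) K) = c • !![φ, 1; 1, -φ])
    (hMT : (MT : Matrix (Fin 2) (Fin 2) K) = !![ζ ^ 2, 0; 0, ζ ^ 3]) :
    NFRel MS MT (dK K) := by
  have hc' : 5 * c = 2 * ζ - ζ ^ 2 + ζ ^ 3 - 2 * ζ ^ 4 := by rw [hc]; field_simp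
  have hD2 : (!![0, -1; 1, 0] : Matrix (Fin 2) (Fin 2) K) ^ 2 = -1 := by
    rw [pow_two]; ext i j; fin_cases i <;> fin_cases j <;> simp
  have hD3 : (!![0, -1; 1, 0] : Matrix (Fin 2) (Fin 2) K) ^ 3 = - !![0, -1; 1, 0] := by
    rw [pow_succ, hD2]; simp
  have hD4 : (!![0, -1; 1, 0] : Matrix (Fin 2) (Fin 2) K) ^ 4 = 1 := by
    rw [show 4 = 2 * 2 from rfl, pow_mul, hD2]; simp
  have h10 : (ζ ^ 2) ^ 5 = 1 := by rw [← pow_mul, mul_comm, pow_mul, h5, one_pow]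
  have h15 : (ζ ^ 3) ^ 5 = 1 := by rw [← pow_mul, mul_comm, pow_mul, h5, one_pow]
  constructor <;> apply Units.ext <;>
    simp only [Units.val_mul, Units.val_pow_eq_pow_val, Units.val_one, hMS, hMT, dK_coe,
      diag_pow, hD2, hD3, hD4, h10, h15]
  · ext i j; fin_cases i <;> fin_cases j <;> simp
  all_goals
    ext i j; fin_cases i <;> fin_cases j <;> simp [Matrix.mul_apply, Fin.sum_univ_two] <;> grind

lemma faithK (h : 1 + ζ + ζ ^ 2 + ζ ^ 3 + ζ ^ 4 = 0) (hζ : IsPrimitiveRoot ζ 5)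
    (MS MT : GL (Fin 2) K)
    (c φ : K) (hc0 : c ≠ 0) (hφ : φ = 1 + ζ + ζ ^ 4)
    (hMS : (MS : Matrix (Fin 2) (Fin 2) K) = c • !![φ, 1; 1, -φ])
    (hMT : (MT : Matrix (Fin 2) (Fin 2) K) = !![ζ ^ 2, 0; 0, ζ ^ 3]) :
    NFRel.Faithful MS MT (dK K) := by
  have hζ0 : ζ ≠ 0 := hζ.ne_zero (by norm_num)
  have h5 := hζ.pow_eq_one
  have hφ0 : φ ≠ 0 := by
    intro h0
    have : φ * (φ - 1) = 1 := by grind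
    simp [h0] at this
  have hD2 : (!![0, -1; 1, 0] : Matrix (Fin 2) (Fin 2) K) ^ 2 = -1 := by
    rw [pow_two]; ext i j; fin_cases i <;> fin_cases j <;> simp
  have hD3 : (!![0, -1; 1, 0] : Matrix (Fin 2) (Fin 2) K) ^ 3 = - !![0, -1; 1, 0] := by
    rw [pow_succ, hD2]; simp
  constructor
  · intro i hi b hb e
    have e' := congrArg (fun g : GL (Fin 2) K => (g : Matrix (Fin 2) (Fin 2) K) 0 0) e
    simp only [Units.val_mul, Units.val_pow_eq_pow_val, Units.val_one, hMT, dK_coe,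
      diag_pow] at e'
    interval_cases i
    · simp [← pow_mul] at e'
      have := (hζ.pow_eq_one_iff_dvd _).1 e'
      omega
    · simp [Matrix.mul_apply, Fin.sum_univ_two] at e'
    · rw [hD2] at e'
      simp [← pow_mul] at e'
      exfalso
      have h1 : ζ ^ (2 * b) = -1 := by rw [← e', neg_neg]
      have h2 : (ζ ^ (2 * b)) ^ 5 = 1 := by rw [← pow_mul, mul_comm, pow_mul, h5, one_pow]
      rw [h1] at h2
      norm_num at h2
    · rw [hD3] at e'
      simp [Matrix.mul_apply, Fin.sum_univ_two] at e'
  · intro i hi a ha b hb e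
    have e1 := congrArg (fun g : GL (Fin 2) K => (g : Matrix (Fin 2) (Fin 2) K) 0 0) e
    have e2 := congrArg (fun g : GL (Fin 2) K => (g : Matrix (Fin 2) (Fin 2) K) 0 1) e
    simp only [Units.val_mul, Units.val_pow_eq_pow_val, Units.val_one, hMT, hMS, dK_coe,
      diag_pow] at e1 e2
    interval_cases i
    · simp [Matrix.mul_apply, Fin.sum_univ_two, hζ0, hc0, hφ0] at e2
    · simp [Matrix.mul_apply, Fin.sum_univ_two, hζ0, hc0, hφ0] at e2
    · rw [hD2] at e2
      simp [Matrix.mul_apply, Fin.sum_univ_two, hζ0, hc0, hφ0] at e2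
    · rw [hD3] at e2
      simp [Matrix.mul_apply, Fin.sum_univ_two, hζ0, hc0, hφ0] at e2

end K

/-- The subgroup of `GL₂(K)` generated by `M_S = κ⁻¹ [[φ,1],[1,-φ]]` and
`M_T = [[ζ²,0],[0,ζ³]]` consists of matrices of determinant one, has order 120,
and is isomorphic to `SL₂(ℤ/5ℤ)`. -/
theorem subgroup_generated_by_MS_MT
    (K : Type*) [Field K] [CharZero K] (ζ φ κ : K)
    (hζ : IsPrimitiveRoot ζ 5) (hφ : φ = 1 + ζ + ζ ^ 4) (hκ : κ = ζ ^ 4 - ζ)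
    (MS MT : GL (Fin 2) K)
    (hMS : (MS : Matrix (Fin 2) (Fin 2) K) = κ⁻¹ • !![φ, 1; 1, -φ])
    (hMT : (MT : Matrix (Fin 2) (Fin 2) K) = !![ζ ^ 2, 0; 0, ζ ^ 3]) :
    (MS : Matrix (Fin 2) (Fin 2) K).det = 1 ∧
    (MT : Matrix (Fin 2) (Fin 2) K).det = 1 ∧
    Nat.card ↥(Subgroup.closure ({MS, MT} : Set (GL (Fin 2) K))) = 120 ∧
    Nonempty (↥(Subgroup.closure ({MS, MT} : Set (GL (Fin 2) K))) ≃*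
      Matrix.SpecialLinearGroup (Fin 2) (ZMod 5)) := by
  have h := phi5 hζ
  have h5 := hζ.pow_eq_one
  have hk := kappa_inv h
  rw [← hκ] at hk
  have hκ0 : κ ≠ 0 := by
    intro h0
    have h3 : ζ * (ζ ^ 3 - 1) = 0 := by rw [← h0, hκ]; ring
    rcases mul_eq_zero.1 h3 with h3 | h3
    · exact hζ.ne_zero (by norm_num) h3
    · have := (hζ.pow_eq_one_iff_dvd 3).1 (sub_eq_zero.1 h3)
      omega
  have hrel := relK h h5 MS MT _ φ hk hφ hMS hMT
  have hf := faithK h hζ MS MT _ φ (inv_ne_zero hκ0) hφ hMS hMT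
  obtain ⟨e⟩ := hrel.iso relF hf faithF
  rw [closF] at e
  have e' := e.trans Subgroup.topEquiv
  refine ⟨?_, ?_, ?_, ⟨e'⟩⟩
  · have hc' : 5 * κ⁻¹ = 2 * ζ - ζ ^ 2 + ζ ^ 3 - 2 * ζ ^ 4 := by rw [hk]; field_simp
    rw [hMS, Matrix.det_fin_two]
    simp
    grind
  · rw [hMT, Matrix.det_fin_two]
    simp
    rw [← pow_add, h5]
  · rw [Nat.card_congr e'.toEquiv]
    exact card_SLF
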